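/- arXiv:1003.0080 — 13 statements merged into one kernel-verified Lean document; each statement's English description precedes it below -/
import Mathlib

section
/- For every real number Γ and all smooth functions F, G, H : ℝ³ → ℝ, the magnetic Poisson bracket satisfies the Jacobi identity: {F, {G, H}_Γ}_Γ + {G, {H, F}_Γ}_Γ + {H, {F, G}_Γ}_Γ = 0 identically on ℝ³. In particular {·,·}_Γ is a Poisson bracket on ℝ³. -/
/-- Partial derivative of `F : (Fin 3 → ℝ) → ℝ` in the `i`-th coordinate direction. -/
noncomputable def pd (i : Fin 3) (F : (Fin 3 → ℝ) → ℝ) (p : Fin 3 → ℝ) : ℝ :=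
  fderiv ℝ F p (Pi.single i 1)

/-- The magnetic Poisson bracket on ℝ³ with coordinates `(Π, Pₓ, P_y) = (p 0, p 1, p 2)`
and circulation `Γ`. -/
noncomputable def magBracket (Γ : ℝ) (F G : (Fin 3 → ℝ) → ℝ) (p : Fin 3 → ℝ) : ℝ :=
  -(p 2) * (pd 0 F p * pd 1 G p - pd 1 F p * pd 0 G p)
    + (p 1) * (pd 0 F p * pd 2 G p - pd 2 F p * pd 0 G p)
    - Γ * (pd 1 F p * pd 2 G p - pd 2 F p * pd 1 G p)

theorem two_le_smooth : (2 : WithTop ℕ∞) ≤ ((⊤ : ℕ∞) : WithTop ℕ∞) :=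
  WithTop.coe_le_coe.2 (le_top : (2 : ℕ∞) ≤ ⊤)

theorem pd_differentiable (i : Fin 3) {F : (Fin 3 → ℝ) → ℝ}
    (hF : ContDiff ℝ (⊤ : ℕ∞) F) : Differentiable ℝ (pd i F) := by
  have h : ContDiff ℝ 1 (fderiv ℝ F) := hF.fderiv_right (by rw [one_add_one_eq_two]; exact two_le_smooth)
  exact (h.differentiable (by norm_num)).clm_apply (differentiable_const _)

theorem pd_pd (i j : Fin 3) {F : (Fin 3 → ℝ) → ℝ}
    (hF : ContDiff ℝ (⊤ : ℕ∞) F) (p : Fin 3 → ℝ) :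
    pd i (pd j F) p = fderiv ℝ (fderiv ℝ F) p (Pi.single i 1) (Pi.single j 1) := by
  have h : ContDiff ℝ 1 (fderiv ℝ F) := hF.fderiv_right (by rw [one_add_one_eq_two]; exact two_le_smooth)
  have h2 := (h.differentiable (by norm_num) p).hasFDerivAt.clm_apply
    (hasFDerivAt_const (Pi.single j (1 : ℝ) : Fin 3 → ℝ) p)
  have h3 : fderiv ℝ (pd j F) p = _ := h2.fderiv
  unfold pd at h3 ⊢
  rw [h3]
  simp

theorem pd_comm (i j : Fin 3) {F : (Fin 3 → ℝ) → ℝ}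
    (hF : ContDiff ℝ (⊤ : ℕ∞) F) (p : Fin 3 → ℝ) :
    pd i (pd j F) p = pd j (pd i F) p := by
  rw [pd_pd i j hF, pd_pd j i hF]
  have h : IsSymmSndFDerivAt ℝ F p := by
    apply hF.contDiffAt.isSymmSndFDerivAt
    simp only [minSmoothness_of_isRCLikeNormedField]
    exact two_le_smooth
  exact h _ _

theorem pd_add {A B : (Fin 3 → ℝ) → ℝ} (i : Fin 3) (p : Fin 3 → ℝ)
    (hA : DifferentiableAt ℝ A p) (hB : DifferentiableAt ℝ B p) :
    pd i (fun q => A q + B q) p = pd i A p + pd i B p := by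
  unfold pd; rw [fderiv_fun_add hA hB]; rfl

theorem pd_sub {A B : (Fin 3 → ℝ) → ℝ} (i : Fin 3) (p : Fin 3 → ℝ)
    (hA : DifferentiableAt ℝ A p) (hB : DifferentiableAt ℝ B p) :
    pd i (fun q => A q - B q) p = pd i A p - pd i B p := by
  unfold pd; rw [fderiv_fun_sub hA hB]; rfl

theorem pd_mul {A B : (Fin 3 → ℝ) → ℝ} (i : Fin 3) (p : Fin 3 → ℝ)
    (hA : DifferentiableAt ℝ A p) (hB : DifferentiableAt ℝ B p) :
    pd i (fun q => A q * B q) p = A p * pd i B p + B p * pd i A p := by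
  unfold pd; rw [fderiv_fun_mul hA hB]; rfl

theorem pd_neg {A : (Fin 3 → ℝ) → ℝ} (i : Fin 3) (p : Fin 3 → ℝ) :
    pd i (fun q => -A q) p = -pd i A p := by
  unfold pd; rw [fderiv_fun_neg]; rfl

theorem pd_const (c : ℝ) (i : Fin 3) (p : Fin 3 → ℝ) :
    pd i (fun _ => c) p = 0 := by
  unfold pd; simp

theorem pd_coord (j i : Fin 3) (p : Fin 3 → ℝ) :
    pd i (fun q => q j) p = (Pi.single i 1 : Fin 3 → ℝ) j := by
  unfold pd; rw [fderiv_apply (differentiableAt_id)] <;> simp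

theorem pd_magBracket (Γ : ℝ) {F G : (Fin 3 → ℝ) → ℝ}
    (hF : ContDiff ℝ (⊤ : ℕ∞) F) (hG : ContDiff ℝ (⊤ : ℕ∞) G) (i : Fin 3) (p : Fin 3 → ℝ) :
    pd i (magBracket Γ F G) p =
      -(Pi.single i 1 : Fin 3 → ℝ) 2 * (pd 0 F p * pd 1 G p - pd 1 F p * pd 0 G p)
      + (Pi.single i 1 : Fin 3 → ℝ) 1 * (pd 0 F p * pd 2 G p - pd 2 F p * pd 0 G p)
      - (p 2) * (pd i (pd 0 F) p * pd 1 G p + pd 0 F p * pd i (pd 1 G) p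
          - pd i (pd 1 F) p * pd 0 G p - pd 1 F p * pd i (pd 0 G) p)
      + (p 1) * (pd i (pd 0 F) p * pd 2 G p + pd 0 F p * pd i (pd 2 G) p
          - pd i (pd 2 F) p * pd 0 G p - pd 2 F p * pd i (pd 0 G) p)
      - Γ * (pd i (pd 1 F) p * pd 2 G p + pd 1 F p * pd i (pd 2 G) p
          - pd i (pd 2 F) p * pd 1 G p - pd 2 F p * pd i (pd 1 G) p) := by
  have f := fun j => pd_differentiable j hF
  have g := fun j => pd_differentiable j hG
  have f0 := f 0
  have f1 := f 1
  have f2 := f 2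
  have g0 := g 0
  have g1 := g 1
  have g2 := g 2
  have e : magBracket Γ F G = fun p => -(p 2) * (pd 0 F p * pd 1 G p - pd 1 F p * pd 0 G p)
    + (p 1) * (pd 0 F p * pd 2 G p - pd 2 F p * pd 0 G p)
    - Γ * (pd 1 F p * pd 2 G p - pd 2 F p * pd 1 G p) := rfl
  rw [e, pd_sub _ _ (by fun_prop) (by fun_prop), pd_add _ _ (by fun_prop) (by fun_prop)]
  rw [pd_mul (A := fun p => -(p 2)) _ _ (by fun_prop) (by fun_prop),
    pd_mul (A := fun p => p 1) _ _ (by fun_prop) (by fun_prop),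
    pd_mul (A := fun _ => Γ) _ _ (by fun_prop) (by fun_prop)]
  have key : ∀ a b, pd i (fun q => pd a F q * pd b G q - pd b F q * pd a G q) p
      = (pd a F p * pd i (pd b G) p + pd b G p * pd i (pd a F) p)
        - (pd b F p * pd i (pd a G) p + pd a G p * pd i (pd b F) p) := by
    intro a b
    rw [pd_sub _ _ ((f a p).fun_mul (g b p)) ((f b p).fun_mul (g a p)),
      pd_mul _ _ (f a p) (g b p), pd_mul _ _ (f b p) (g a p)]
  rw [key, key, key, pd_neg, pd_coord, pd_coord, pd_const]
  ring

/-- The magnetic Poisson bracket satisfies the Jacobi identity. -/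
theorem magBracket_jacobi (Γ : ℝ) (F G H : (Fin 3 → ℝ) → ℝ)
    (hF : ContDiff ℝ (⊤ : ℕ∞) F) (hG : ContDiff ℝ (⊤ : ℕ∞) G) (hH : ContDiff ℝ (⊤ : ℕ∞) H) :
    ∀ p : Fin 3 → ℝ,
      magBracket Γ F (magBracket Γ G H) p
        + magBracket Γ G (magBracket Γ H F) p
        + magBracket Γ H (magBracket Γ F G) p = 0 := by
  intro p
  rw [magBracket, magBracket, magBracket]
  simp only [pd_magBracket Γ hF hG, pd_magBracket Γ hG hH, pd_magBracket Γ hH hF]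
  rw [pd_comm 1 0 hF, pd_comm 2 0 hF, pd_comm 2 1 hF, pd_comm 1 0 hG, pd_comm 2 0 hG,
    pd_comm 2 1 hG, pd_comm 1 0 hH, pd_comm 2 0 hH, pd_comm 2 1 hH]
  simp [Pi.single_apply]
  ring
end

section
/- Let M be an invertible symmetric 3×3 real matrix, Γ ∈ ℝ, and let H : ℝ³ → ℝ be the kinetic-energy Hamiltonian H(π) = (1/2) π · (M⁻¹ π). Then for every differentiable function F : ℝ³ → ℝ and every π = (Π, Pₓ, P_y) ∈ ℝ³, {F, H}_Γ(π) = ∇F(π) · (Pₓ V_y − P_y Vₓ, P_y Ω − Γ V_y, −Pₓ Ω + Γ Vₓ), where (Ω, Vₓ, V_y) := M⁻¹ (Π, Pₓ, P_y). Hence Hamilton's equations for H with respect to the magnetic Poisson bracket are exactly the Chaplygin–Lamb equations for a rigid body with circulation Γ. -/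
open Matrix

theorem pd_quad (A : Matrix (Fin 3) (Fin 3) ℝ) (hA : Aᵀ = A) (i : Fin 3) (p : Fin 3 → ℝ) :
    pd i (fun q => (1 / 2) * (q ⬝ᵥ (A *ᵥ q))) p = (A *ᵥ p) i := by
  have h10 : A 1 0 = A 0 1 := congrFun (congrFun hA 0) 1
  have h20 : A 2 0 = A 0 2 := congrFun (congrFun hA 0) 2
  have h21 : A 2 1 = A 1 2 := congrFun (congrFun hA 1) 2
  have hd : DifferentiableAt ℝ (fun q : Fin 3 → ℝ => (1 / 2) * (q ⬝ᵥ (A *ᵥ q))) p := by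
    simp only [dotProduct, mulVec, Fin.sum_univ_three]
    fun_prop
  have h1 := hd.hasFDerivAt.hasLineDerivAt (Pi.single i 1)
  have h2 : HasDerivAt (fun t : ℝ => (1 / 2) * (p ⬝ᵥ (A *ᵥ p)) + t * (A *ᵥ p) i
      + t ^ 2 * (A i i / 2)) ((A *ᵥ p) i) 0 := by
    have := (((hasDerivAt_id (0:ℝ)).mul_const ((A *ᵥ p) i)).const_add
      ((1 / 2) * (p ⬝ᵥ (A *ᵥ p)))).add (((hasDerivAt_id (0:ℝ)).pow 2).mul_const (A i i / 2))
    exact this.congr_deriv (by simp)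
  unfold pd
  refine HasDerivAt.unique h1 (h2.congr_deriv rfl |>.congr_of_eventuallyEq
    (Filter.Eventually.of_forall fun t => ?_))
  fin_cases i <;>
    simp [dotProduct, mulVec, Fin.sum_univ_three, h10, h20, h21, Pi.single_apply] <;> ring

/-- Hamilton's equations for the kinetic-energy Hamiltonian `H(π) = (1/2) π · (M⁻¹ π)`
with respect to the magnetic Poisson bracket are the Chaplygin–Lamb equations. -/
theorem magBracket_kinetic_hamiltonian
    (M : Matrix (Fin 3) (Fin 3) ℝ) (hM : IsUnit M.det) (hMsymm : Mᵀ = M)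
    (Γ : ℝ) (F : (Fin 3 → ℝ) → ℝ) (hF : Differentiable ℝ F) :
    ∀ p : Fin 3 → ℝ,
      magBracket Γ F (fun q => (1 / 2) * (q ⬝ᵥ (M⁻¹ *ᵥ q))) p =
        pd 0 F p * ((p 1) * (M⁻¹ *ᵥ p) 2 - (p 2) * (M⁻¹ *ᵥ p) 1)
          + pd 1 F p * ((p 2) * (M⁻¹ *ᵥ p) 0 - Γ * (M⁻¹ *ᵥ p) 2)
          + pd 2 F p * (-(p 1) * (M⁻¹ *ᵥ p) 0 + Γ * (M⁻¹ *ᵥ p) 1) := by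
  intro p
  have hA : (M⁻¹)ᵀ = M⁻¹ := by rw [Matrix.transpose_nonsing_inv, hMsymm]
  unfold magBracket
  simp only [pd_quad _ hA]
  ring
end

section
/- Let M be an invertible symmetric 3×3 real matrix and Γ ∈ ℝ. If t ↦ π(t) = (Π(t), Pₓ(t), P_y(t)) is a differentiable curve on a real interval satisfying the Chaplygin–Lamb equations, then the kinetic energy H(π(t)) = (1/2) π(t) · (M⁻¹ π(t)) is constant in t. -/
open Matrix

/-- Along any solution of the Chaplygin–Lamb equations on a real interval, the kinetic
energy `H(π) = (1/2) π · (M⁻¹ π)` is conserved. -/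
theorem energy_conserved_chaplygin_lamb
    (M : Matrix (Fin 3) (Fin 3) ℝ) (hM : IsUnit M.det) (hMsymm : Mᵀ = M)
    (Γ : ℝ) (I : Set ℝ) (hI : I.OrdConnected)
    (π : ℝ → Fin 3 → ℝ)
    (hode : ∀ t ∈ I, HasDerivAt π
      (fun i : Fin 3 =>
        let v := M⁻¹ *ᵥ (π t)
        ![ (π t 1) * v 2 - (π t 2) * v 1,
           (π t 2) * v 0 - Γ * v 2,
           -(π t 1) * v 0 + Γ * v 1 ] i) t) :
    ∀ t ∈ I, ∀ t' ∈ I,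
      (1 / 2) * (π t ⬝ᵥ (M⁻¹ *ᵥ π t)) = (1 / 2) * (π t' ⬝ᵥ (M⁻¹ *ᵥ π t')) := by
  have hS : (M⁻¹)ᵀ = M⁻¹ := by rw [Matrix.transpose_nonsing_inv, hMsymm]
  revert hode
  generalize M⁻¹ = A at hS ⊢
  intro hode
  have h10 : A 1 0 = A 0 1 := congrFun (congrFun hS 0) 1
  have h20 : A 2 0 = A 0 2 := congrFun (congrFun hS 0) 2
  have h21 : A 2 1 = A 1 2 := congrFun (congrFun hS 1) 2
  have key : ∀ t ∈ I, HasDerivWithinAt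
      (fun t => (1 / 2 : ℝ) * (π t ⬝ᵥ (A *ᵥ π t))) 0 I t := by
    intro t ht
    have h := hasDerivAt_pi.1 (hode t ht)
    have h0 := h 0
    have h1 := h 1
    have h2 := h 2
    simp [Matrix.mulVec, dotProduct, Fin.sum_univ_three] at h0 h1 h2
    apply HasDerivAt.hasDerivWithinAt
    simp only [Matrix.mulVec, dotProduct, Fin.sum_univ_three, h10, h20, h21] at h0 h1 h2 ⊢
    have e := ((((h0.mul (((h0.const_mul (A 0 0)).add (h1.const_mul (A 0 1))).add
        (h2.const_mul (A 0 2)))).add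
      (h1.mul (((h0.const_mul (A 0 1)).add (h1.const_mul (A 1 1))).add
        (h2.const_mul (A 1 2))))).add
      (h2.mul (((h0.const_mul (A 0 2)).add (h1.const_mul (A 1 2))).add
        (h2.const_mul (A 2 2))))).const_mul (1 / 2 : ℝ))
    refine e.congr_deriv ?_
    simp only [Pi.add_apply]
    ring
  intro t ht t' ht'
  have := hI.convex.norm_image_sub_le_of_norm_hasDerivWithin_le (C := 0) key
    (fun x _ => by simp) ht' ht
  simp only [zero_mul] at this
  exact sub_eq_zero.1 (norm_le_zero_iff.1 this)
end

section
/- Let M be an invertible symmetric 3×3 real matrix and Γ ≠ 0. If t ↦ (Π(t), Pₓ(t), P_y(t)) is a differentiable curve on a real interval satisfying the Chaplygin–Lamb equations, then the Casimir function Φ = Π(t) + (Pₓ(t)² + P_y(t)²)/(2Γ) is constant in t. Hence every trajectory of a rigid body with circulation lies in the intersection of a level set of the energy with a paraboloid of revolution Φ = const. -/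
open Matrix

/-- Along any solution of the Chaplygin–Lamb equations on a real interval, the Casimir
function `Φ = Π + (Pₓ² + P_y²)/(2Γ)` is conserved. -/
theorem casimir_conserved_chaplygin_lamb
    (M : Matrix (Fin 3) (Fin 3) ℝ) (hM : IsUnit M.det) (hMsymm : Mᵀ = M)
    (Γ : ℝ) (hΓ : Γ ≠ 0) (I : Set ℝ) (hI : I.OrdConnected)
    (π : ℝ → Fin 3 → ℝ)
    (hode : ∀ t ∈ I, HasDerivAt π
      (fun i : Fin 3 =>
        let v := M⁻¹ *ᵥ (π t)
        ![ (π t 1) * v 2 - (π t 2) * v 1,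
           (π t 2) * v 0 - Γ * v 2,
           -(π t 1) * v 0 + Γ * v 1 ] i) t) :
    ∀ t ∈ I, ∀ t' ∈ I,
      π t 0 + ((π t 1) ^ 2 + (π t 2) ^ 2) / (2 * Γ) =
        π t' 0 + ((π t' 1) ^ 2 + (π t' 2) ^ 2) / (2 * Γ) := by
  have hd : ∀ s ∈ I, HasDerivAt
      (fun s => π s 0 + ((π s 1) ^ 2 + (π s 2) ^ 2) / (2 * Γ)) 0 s := by
    intro s hs
    have h := hasDerivAt_pi.1 (hode s hs)
    have h0 := h 0
    have h1 := h 1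
    have h2 := h 2
    refine (h0.add (((h1.pow 2).add (h2.pow 2)).div_const (2 * Γ))).congr_deriv ?_
    simp
    field_simp
    ring
  intro t ht t' ht'
  have hc : Convex ℝ I := hI.convex
  have key := hc.norm_image_sub_le_of_norm_hasDerivWithin_le (C := 0)
    (fun s hs => (hd s hs).hasDerivWithinAt) (by simp) ht' ht
  rw [zero_mul] at key
  exact sub_eq_zero.1 (norm_le_zero_iff.1 key)
end

section
/- Fix Γ ∈ ℝ. Define ψ : SE(2) → ℝ × ℝ² by ψ(θ, x₀) = (−(Γ/4)‖x₀‖², (Γ/2) J x₀), and the coadjoint action of SE(2) on ℝ × ℝ² by a(θ, x₀)(Π, P) = (Π − P · (R_θᵀ J x₀), R_θ P). Then ψ is a group one-cocycle relative to the coadjoint action: for all g, h ∈ SE(2), ψ(g · h) = a(g)(ψ(h)) + ψ(g), where addition is componentwise in ℝ × ℝ². -/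
/-- The rotation matrix `R_θ` applied to a vector of `ℝ²`. -/
noncomputable def Rot (θ : ℝ) (v : ℝ × ℝ) : ℝ × ℝ :=
  (Real.cos θ * v.1 - Real.sin θ * v.2, Real.sin θ * v.1 + Real.cos θ * v.2)

/-- The matrix `J` with rows `(0,1)` and `(-1,0)`. -/
def Jmat (v : ℝ × ℝ) : ℝ × ℝ := (v.2, -v.1)

/-- Euclidean dot product on ℝ². -/
def dot2 (u v : ℝ × ℝ) : ℝ := u.1 * v.1 + u.2 * v.2

/-- Multiplication in `SE(2)`, modelled as `ℝ × ℝ²`. -/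
noncomputable def se2mul (g h : ℝ × (ℝ × ℝ)) : ℝ × (ℝ × ℝ) :=
  (g.1 + h.1, g.2 + Rot g.1 h.2)

/-- The coadjoint action of `SE(2)` on `ℝ × ℝ²`:
`a(θ, x₀)(Π, P) = (Π − P · (R_θᵀ J x₀), R_θ P)`. -/
noncomputable def coad (g : ℝ × (ℝ × ℝ)) (μ : ℝ × (ℝ × ℝ)) : ℝ × (ℝ × ℝ) :=
  (μ.1 - dot2 μ.2 (Rot (-g.1) (Jmat g.2)), Rot g.1 μ.2)

/-- The `B_Γ`-potential `ψ(θ, x₀) = (−(Γ/4)‖x₀‖², (Γ/2) J x₀)`. -/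
noncomputable def ψpot (Γ : ℝ) (g : ℝ × (ℝ × ℝ)) : ℝ × (ℝ × ℝ) :=
  (-(Γ / 4) * (g.2.1 ^ 2 + g.2.2 ^ 2), (Γ / 2) • Jmat g.2)

/-- `ψ` is a group one-cocycle relative to the coadjoint action of `SE(2)`. -/
theorem ψpot_cocycle (Γ : ℝ) :
    ∀ g h : ℝ × (ℝ × ℝ),
      ψpot Γ (se2mul g h) = coad g (ψpot Γ h) + ψpot Γ g := by
  rintro ⟨θ, x, y⟩ ⟨φ, u, v⟩
  have h := Real.sin_sq_add_cos_sq θ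
  refine Prod.ext ?_ (Prod.ext ?_ ?_)
  · simp only [ψpot, se2mul, coad, Rot, Jmat, dot2, Prod.fst_add, Prod.snd_add, Prod.smul_fst,
      Prod.smul_snd, smul_eq_mul, Real.cos_neg, Real.sin_neg]
    linear_combination (-(Γ / 4) * (u ^ 2 + v ^ 2)) * h
  · simp only [ψpot, se2mul, coad, Rot, Jmat, Prod.fst_add, Prod.snd_add, Prod.smul_fst,
      Prod.smul_snd, smul_eq_mul]
    ring
  · simp only [ψpot, se2mul, coad, Rot, Jmat, Prod.fst_add, Prod.snd_add, Prod.smul_fst,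
      Prod.smul_snd, smul_eq_mul]
    ring
end

section
/- Fix Γ ∈ ℝ. The map (θ, x₀) • (Π, P) = (Π − P · (R_θᵀ J x₀) − (Γ/4)‖x₀‖², R_θ P + (Γ/2) J x₀) defines a left group action of SE(2) on ℝ³ = ℝ × ℝ²: the identity (0, 0) acts trivially, and g • (h • μ) = (g · h) • μ for all g, h ∈ SE(2) and μ ∈ ℝ × ℝ². -/
/-- The affine action of `SE(2)` on `ℝ × ℝ²`:
`(θ, x₀) • (Π, P) = (Π − P·(R_θᵀ J x₀) − (Γ/4)‖x₀‖², R_θ P + (Γ/2) J x₀)`. -/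
noncomputable def affAct (Γ : ℝ) (g : ℝ × (ℝ × ℝ)) (μ : ℝ × (ℝ × ℝ)) : ℝ × (ℝ × ℝ) :=
  (μ.1 - dot2 μ.2 (Rot (-g.1) (Jmat g.2)) - (Γ / 4) * (g.2.1 ^ 2 + g.2.2 ^ 2),
    Rot g.1 μ.2 + (Γ / 2) • Jmat g.2)

/-- The affine map `affAct Γ` is a left group action of `SE(2)` on `ℝ × ℝ²`. -/
theorem affAct_is_action (Γ : ℝ) :
    (∀ μ : ℝ × (ℝ × ℝ), affAct Γ ((0 : ℝ), ((0 : ℝ), (0 : ℝ))) μ = μ) ∧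
    (∀ g h : ℝ × (ℝ × ℝ), ∀ μ : ℝ × (ℝ × ℝ),
      affAct Γ g (affAct Γ h μ) = affAct Γ (se2mul g h) μ) := by
  constructor
  · rintro ⟨p, a, b⟩
    simp [affAct, Rot, Jmat, dot2]
  · rintro ⟨t, x, y⟩ ⟨f, u, v⟩ ⟨p, a, b⟩
    have h := Real.sin_sq_add_cos_sq t
    simp only [affAct, se2mul, Rot, Jmat, dot2, Prod.mk_add_mk, Prod.smul_mk, smul_eq_mul,
      Prod.mk.injEq, Real.cos_neg, Real.sin_neg, Real.cos_add, Real.sin_add]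
    refine ⟨?_, ?_, ?_⟩
    · linear_combination (a * (Real.cos f * v - Real.sin f * u)
        + b * (-Real.sin f * v - Real.cos f * u) + Γ / 4 * (u ^ 2 + v ^ 2)) * h
    · ring
    · ring
end

section
/- Fix Γ ≠ 0. The function Φ(Π, P) = Π + ‖P‖²/Γ on ℝ × ℝ² is invariant under the affine SE(2)-action: for every (θ, x₀) ∈ SE(2) and every (Π, P) ∈ ℝ × ℝ², Φ((θ, x₀) • (Π, P)) = Φ(Π, P). -/
/-- The Casimir `Φ(Π, P) = Π + ‖P‖²/Γ`. -/
noncomputable def casimirΦ (Γ : ℝ) (μ : ℝ × (ℝ × ℝ)) : ℝ :=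
  μ.1 + (μ.2.1 ^ 2 + μ.2.2 ^ 2) / Γ

/-- `Φ` is invariant under the affine `SE(2)`-action. -/
theorem casimirΦ_invariant (Γ : ℝ) (hΓ : Γ ≠ 0) :
    ∀ g μ : ℝ × (ℝ × ℝ), casimirΦ Γ (affAct Γ g μ) = casimirΦ Γ μ := by
  rintro ⟨θ, x, y⟩ ⟨m, p, q⟩
  have h := Real.sin_sq_add_cos_sq θ
  simp only [casimirΦ, affAct, Rot, Jmat, dot2, Real.cos_neg, Real.sin_neg, Prod.fst_add,
    Prod.snd_add, Prod.smul_fst, Prod.smul_snd, smul_eq_mul]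
  have key : (Real.cos θ * p - Real.sin θ * q + Γ / 2 * y) ^ 2
      + (Real.sin θ * p + Real.cos θ * q + Γ / 2 * -x) ^ 2
      = (p ^ 2 + q ^ 2) + Γ * ((Real.cos θ * p - Real.sin θ * q) * y
        - (Real.sin θ * p + Real.cos θ * q) * x + Γ / 4 * (x ^ 2 + y ^ 2)) := by
    linear_combination (p ^ 2 + q ^ 2) * h
  rw [key, add_div, mul_div_cancel_left₀ _ hΓ]
  ring
end

section
/- Fix Γ ≠ 0 and let Φ(Π, P) = Π + ‖P‖²/Γ on ℝ × ℝ². The affine SE(2)-action acts transitively on each level set of Φ: if (Π, P) and (Π', P') satisfy Φ(Π, P) = Φ(Π', P'), then there exists g ∈ SE(2) with g • (Π, P) = (Π', P'). Combined with the invariance of Φ, the orbits of the affine action are exactly the level sets of Φ, i.e. paraboloids of revolution about the Π-axis. -/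
/-- The affine `SE(2)`-action is transitive on each level set of `Φ`. -/
theorem affAct_transitive_on_levels (Γ : ℝ) (hΓ : Γ ≠ 0) :
    ∀ μ μ' : ℝ × (ℝ × ℝ), casimirΦ Γ μ = casimirΦ Γ μ' →
      ∃ g : ℝ × (ℝ × ℝ), affAct Γ g μ = μ' := by
  rintro ⟨a, p, q⟩ ⟨b, r, s⟩ h
  simp only [casimirΦ] at h
  have hb : b = a + (p ^ 2 + q ^ 2) / Γ - (r ^ 2 + s ^ 2) / Γ := by linarith
  refine ⟨(0, (-(2 / Γ * (s - q)), 2 / Γ * (r - p))), ?_⟩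
  subst hb
  simp only [affAct, Rot, Jmat, dot2, neg_zero, Real.cos_zero, Real.sin_zero, Prod.smul_mk,
    Prod.mk_add_mk, smul_eq_mul, Prod.mk.injEq]
  refine ⟨?_, ?_, ?_⟩ <;> field_simp <;> ring
end

section
/- Fix Γ ∈ ℝ. For ξ = (Ω, Vₓ, V_y) ∈ ℝ³ define the function ψ_ξ : ℝ³ → ℝ by ψ_ξ(θ, x, y) = −(Ω Γ/4)(x² + y²) + (Γ/2)(Vₓ y − V_y x), and the infinitesimal generator of left translations on SE(2) (in coordinates (θ, x, y)) by X_ξ(θ, x, y) = (Ω, Vₓ − Ω y, V_y + Ω x). Then for all ξ = (Ω, Vₓ, V_y), η = (Ω̄, V̄ₓ, V̄_y) ∈ ℝ³ and all (θ, x, y) ∈ ℝ³, the directional derivative of ψ_ξ at (θ, x, y) along the vector X_η(θ, x, y) equals (Γ/2)·[(Vₓ − Ω y)(V̄_y + Ω̄ x) − (V_y + Ω x)(V̄ₓ − Ω̄ y)]. Equivalently, dψ_ξ = i_{X_ξ} B where B is the left-invariant magnetic two-form (Γ/2) dx ∧ dy on SE(2), so ψ = (ψ_ξ)_ξ is a B_Γ-potential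 for the magnetic term generated by the curvature of the Neumann connection. -/
/-- The `B_Γ`-potential component `ψ_ξ` on `SE(2)` (coordinates `(θ, x, y)`), for
`ξ = (Ω, Vₓ, V_y)`:  `ψ_ξ(θ, x, y) = −(ΩΓ/4)(x² + y²) + (Γ/2)(Vₓ y − V_y x)`. -/
noncomputable def ψcomp (Γ Ω Vx Vy : ℝ) (p : ℝ × ℝ × ℝ) : ℝ :=
  -(Ω * Γ / 4) * (p.2.1 ^ 2 + p.2.2 ^ 2) + (Γ / 2) * (Vx * p.2.2 - Vy * p.2.1)

/-- The infinitesimal generator of left translations on `SE(2)` associated to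
`η = (Ω̄, V̄ₓ, V̄_y)`, at the point `(θ, x, y)`. -/
def infGen (Ω' Vx' Vy' : ℝ) (p : ℝ × ℝ × ℝ) : ℝ × ℝ × ℝ :=
  (Ω', Vx' - Ω' * p.2.2, Vy' + Ω' * p.2.1)

/-- `dψ_ξ = i_{X_ξ} B` for the magnetic two-form `B = (Γ/2) dx ∧ dy` on `SE(2)`:
the directional derivative of `ψ_ξ` along `X_η` equals `B(X_ξ, X_η)`. -/
theorem ψcomp_is_Bpotential (Γ Ω Vx Vy Ω' Vx' Vy' : ℝ) (p : ℝ × ℝ × ℝ) :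
    fderiv ℝ (ψcomp Γ Ω Vx Vy) p (infGen Ω' Vx' Vy' p) =
      (Γ / 2) * ((Vx - Ω * p.2.2) * (Vy' + Ω' * p.2.1)
        - (Vy + Ω * p.2.1) * (Vx' - Ω' * p.2.2)) := by
  have hx : HasFDerivAt (fun q : ℝ × ℝ × ℝ => q.2.1)
      ((ContinuousLinearMap.fst ℝ ℝ ℝ).comp (ContinuousLinearMap.snd ℝ ℝ (ℝ × ℝ))) p :=
    ((ContinuousLinearMap.fst ℝ ℝ ℝ).comp (ContinuousLinearMap.snd ℝ ℝ (ℝ × ℝ))).hasFDerivAt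
  have hy : HasFDerivAt (fun q : ℝ × ℝ × ℝ => q.2.2)
      ((ContinuousLinearMap.snd ℝ ℝ ℝ).comp (ContinuousLinearMap.snd ℝ ℝ (ℝ × ℝ))) p :=
    ((ContinuousLinearMap.snd ℝ ℝ ℝ).comp (ContinuousLinearMap.snd ℝ ℝ (ℝ × ℝ))).hasFDerivAt
  have h : HasFDerivAt (ψcomp Γ Ω Vx Vy) _ p :=
    (((hx.pow 2).add (hy.pow 2)).const_mul (-(Ω * Γ / 4))).add
      (((hy.const_mul Vx).sub (hx.const_mul Vy)).const_mul (Γ / 2))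
  rw [h.fderiv]
  simp [infGen]
  ring
end

section
/- Define B : SE(2) × SE(2) → ℝ by B((θ, x₀), (φ, y₀)) = x₀ · (J (R_θ y₀)). Then B is a real-valued group two-cocycle on SE(2): for all g, h, k ∈ SE(2), B(g, h) + B(g·h, k) = B(h, k) + B(g, h·k). Consequently, the set SE(2) × ℝ equipped with the multiplication ((g, a), (h, b)) ↦ (g·h, a + b + B(g, h)) is a group (the oscillator group), with identity ((0, 0), 0). -/
/-- The group two-cocycle `B((θ, x₀), (φ, y₀)) = x₀ · (J (R_θ y₀))` on `SE(2)`. -/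
noncomputable def Bcocycle (g h : ℝ × (ℝ × ℝ)) : ℝ := dot2 g.2 (Jmat (Rot g.1 h.2))

/-- Multiplication in the oscillator group `SE(2) × ℝ`. -/
noncomputable def oscMul (a b : (ℝ × (ℝ × ℝ)) × ℝ) : (ℝ × (ℝ × ℝ)) × ℝ :=
  (se2mul a.1 b.1, a.2 + b.2 + Bcocycle a.1 b.1)

/-- The identity of the oscillator group. -/
def oscOne : (ℝ × (ℝ × ℝ)) × ℝ := (((0 : ℝ), ((0 : ℝ), (0 : ℝ))), (0 : ℝ))

/-- `B` is a group two-cocycle on `SE(2)`, and consequently `SE(2) × ℝ` with the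
twisted multiplication is a group (the oscillator group) with identity `((0,0),0)`. -/
theorem Bcocycle_oscillator_group :
    (∀ g h k : ℝ × (ℝ × ℝ),
      Bcocycle g h + Bcocycle (se2mul g h) k = Bcocycle h k + Bcocycle g (se2mul h k)) ∧
    (∀ a b c : (ℝ × (ℝ × ℝ)) × ℝ, oscMul (oscMul a b) c = oscMul a (oscMul b c)) ∧
    (∀ a : (ℝ × (ℝ × ℝ)) × ℝ, oscMul oscOne a = a ∧ oscMul a oscOne = a) ∧
    (∀ a : (ℝ × (ℝ × ℝ)) × ℝ, ∃ b, oscMul a b = oscOne ∧ oscMul b a = oscOne) := by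
  have hc : ∀ g h k : ℝ × (ℝ × ℝ),
      Bcocycle g h + Bcocycle (se2mul g h) k = Bcocycle h k + Bcocycle g (se2mul h k) := by
    rintro ⟨t, x1, x2⟩ ⟨u, y1, y2⟩ ⟨v, z1, z2⟩
    have e := Real.sin_sq_add_cos_sq t
    simp only [Bcocycle, se2mul, dot2, Jmat, Rot, Prod.fst_add, Prod.snd_add,
      Real.cos_add, Real.sin_add]
    linear_combination (y1 * (Real.sin u * z1 + Real.cos u * z2)
      - y2 * (Real.cos u * z1 - Real.sin u * z2)) * e
  refine ⟨hc, ?_, ?_, ?_⟩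
  · intro a b c
    refine Prod.ext ?_ ?_
    · obtain ⟨⟨t, x1, x2⟩, a⟩ := a
      obtain ⟨⟨u, y1, y2⟩, b⟩ := b
      obtain ⟨⟨v, z1, z2⟩, c⟩ := c
      simp only [oscMul, se2mul, Rot, Prod.mk_add_mk, Real.cos_add, Real.sin_add, Prod.mk.injEq]
      refine ⟨?_, ?_, ?_⟩ <;> ring
    · have := hc a.1 b.1 c.1
      simp only [oscMul]
      linarith
  · rintro ⟨⟨t, x1, x2⟩, a⟩
    constructor <;> simp [oscMul, oscOne, se2mul, Rot, Bcocycle, dot2, Jmat]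
  · rintro ⟨⟨t, x1, x2⟩, a⟩
    have e := Real.sin_sq_add_cos_sq t
    refine ⟨((-t, (-(Real.cos t * x1 + Real.sin t * x2), Real.sin t * x1 - Real.cos t * x2)), -a),
      ?_, ?_⟩
    · simp only [oscMul, oscOne, se2mul, Rot, Bcocycle, dot2, Jmat, Prod.mk_add_mk,
        Prod.mk.injEq]
      refine ⟨⟨by ring, ?_, ?_⟩, ?_⟩
      · linear_combination (-x1) * e
      · linear_combination (-x2) * e
      · ring_nf
    · simp only [oscMul, oscOne, se2mul, Rot, Bcocycle, dot2, Jmat, Prod.mk_add_mk,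
        Prod.mk.injEq, Real.cos_neg, Real.sin_neg]
      refine ⟨⟨by ring, ?_, ?_⟩, ?_⟩ <;> ring
end

section
/- Let g(t) = (θ₁(t), x(t)) and h(s) = (θ₂(s), y(s)) be smooth curves in ℝ × ℝ² with g(0) = h(0) = (0, 0), g'(0) = (Ω₁, V₁) and h'(0) = (Ω₂, V₂). Then the mixed partial derivative at (t, s) = (0, 0) of the function (t, s) ↦ B(g(t), h(s)) − B(h(s), g(t)) equals 2 V₁ · J V₂. That is, the Lie-algebra two-cocycle induced by the group two-cocycle B is C((Ω₁, V₁), (Ω₂, V₂)) = 2 V₁ · J V₂, twice the standard symplectic area form on ℝ² applied to (V₁, V₂). -/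
/-- The Lie-algebra two-cocycle induced by `B` is `C((Ω₁,V₁),(Ω₂,V₂)) = 2 V₁ · J V₂`:
the antisymmetrized mixed second derivative of `B` along curves through the identity
equals twice the symplectic area of the pair of velocity vectors. -/
theorem algebra_cocycle_of_Bcocycle
    (g h : ℝ → ℝ × (ℝ × ℝ)) (hg : ContDiff ℝ (⊤ : ℕ∞) g) (hh : ContDiff ℝ (⊤ : ℕ∞) h)
    (hg0 : g 0 = (0, (0, 0))) (hh0 : h 0 = (0, (0, 0)))
    (Ω₁ Ω₂ : ℝ) (V₁ V₂ : ℝ × ℝ)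
    (hg' : HasDerivAt g (Ω₁, V₁) 0) (hh' : HasDerivAt h (Ω₂, V₂) 0) :
    deriv (fun t => deriv (fun s => Bcocycle (g t) (h s) - Bcocycle (h s) (g t)) 0) 0 =
      2 * dot2 V₁ (Jmat V₂) := by
  have c1 : ∀ {f : ℝ → ℝ × (ℝ × ℝ)} {a : ℝ} {V : ℝ × ℝ}, HasDerivAt f (a, V) 0 →
      HasDerivAt (fun t => (f t).1) a 0 ∧ HasDerivAt (fun t => (f t).2.1) V.1 0 ∧
      HasDerivAt (fun t => (f t).2.2) V.2 0 := by
    intro f a V hf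
    have h2 := hf.snd
    exact ⟨hf.fst, h2.fst, h2.snd⟩
  obtain ⟨g1, g2, g3⟩ := c1 hg'
  obtain ⟨k1, k2, k3⟩ := c1 hh'
  have inner : ∀ t, deriv (fun s => Bcocycle (g t) (h s) - Bcocycle (h s) (g t)) 0 =
      (g t).2.1 * (Real.sin (g t).1 * V₂.1 + Real.cos (g t).1 * V₂.2)
      - (g t).2.2 * (Real.cos (g t).1 * V₂.1 - Real.sin (g t).1 * V₂.2)
      - (V₂.1 * (g t).2.2 - V₂.2 * (g t).2.1) := by
    intro t
    simp only [Bcocycle, dot2, Jmat, Rot]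
    have A := ((((k2.const_mul (Real.sin (g t).1)).add (k3.const_mul (Real.cos (g t).1))).const_mul
      (g t).2.1).add (((k2.const_mul (Real.cos (g t).1)).sub
        (k3.const_mul (Real.sin (g t).1))).neg.const_mul (g t).2.2)).sub
      ((k2.mul ((k1.sin.mul_const (g t).2.1).add (k1.cos.mul_const (g t).2.2))).add
       (k3.mul ((k1.cos.mul_const (g t).2.1).sub (k1.sin.mul_const (g t).2.2)).neg))
    refine Eq.trans (HasDerivAt.deriv A) ?_
    simp [hh0]
    ring
  simp only [inner]
  have A := ((g2.mul ((g1.sin.mul_const V₂.1).add (g1.cos.mul_const V₂.2))).sub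
    (g3.mul ((g1.cos.mul_const V₂.1).sub (g1.sin.mul_const V₂.2)))).sub
    ((g3.const_mul V₂.1).sub (g2.const_mul V₂.2))
  refine Eq.trans (HasDerivAt.deriv A) ?_
  simp [hg0, dot2, Jmat]
  ring
end

section
/- For every Γ ∈ ℝ, the inclusion ι_Γ : ℝ³ → ℝ⁴ given by ι_Γ(Π, Pₓ, P_y) = (Π, Pₓ, P_y, Γ) is a Poisson map from the magnetic Poisson bracket on ℝ³ to the oscillator Poisson bracket on ℝ⁴: for all differentiable functions f, g : ℝ⁴ → ℝ and all π ∈ ℝ³, {f, g}_osc(ι_Γ(π)) = {f ∘ ι_Γ, g ∘ ι_Γ}_Γ(π). In other words, the hyperplane p = Γ is a Poisson submanifold of osc* on which the oscillator bracket restricts to the magnetic bracket with circulation Γ. -/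
/-- Partial derivative of `f : (Fin 4 → ℝ) → ℝ` in the `i`-th coordinate direction. -/
noncomputable def pd4 (i : Fin 4) (f : (Fin 4 → ℝ) → ℝ) (ν : Fin 4 → ℝ) : ℝ :=
  fderiv ℝ f ν (Pi.single i 1)

/-- The oscillator Poisson bracket on `ℝ⁴` with coordinates
`(Π, Pₓ, P_y, p) = (ν 0, ν 1, ν 2, ν 3)`. -/
noncomputable def oscPoisson (f g : (Fin 4 → ℝ) → ℝ) (ν : Fin 4 → ℝ) : ℝ :=
  -(ν 2) * (pd4 0 f ν * pd4 1 g ν - pd4 1 f ν * pd4 0 g ν)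
    + (ν 1) * (pd4 0 f ν * pd4 2 g ν - pd4 2 f ν * pd4 0 g ν)
    - (ν 3) * (pd4 1 f ν * pd4 2 g ν - pd4 2 f ν * pd4 1 g ν)

/-- The inclusion `ι_Γ : ℝ³ → ℝ⁴`, `ι_Γ(Π, Pₓ, P_y) = (Π, Pₓ, P_y, Γ)`. -/
def inclΓ (Γ : ℝ) (π : Fin 3 → ℝ) : Fin 4 → ℝ := ![π 0, π 1, π 2, Γ]

theorem inclΓ_hasFDerivAt (Γ : ℝ) (π : Fin 3 → ℝ) :
    HasFDerivAt (inclΓ Γ) (ContinuousLinearMap.pi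
      (![ContinuousLinearMap.proj 0, ContinuousLinearMap.proj 1,
        ContinuousLinearMap.proj 2, 0] : Fin 4 → ((Fin 3 → ℝ) →L[ℝ] ℝ))) π := by
  rw [hasFDerivAt_pi']
  intro i
  fin_cases i
  · exact hasFDerivAt_apply (𝕜 := ℝ) (0 : Fin 3) π
  · exact hasFDerivAt_apply (𝕜 := ℝ) (1 : Fin 3) π
  · exact hasFDerivAt_apply (𝕜 := ℝ) (2 : Fin 3) π
  · exact hasFDerivAt_const (𝕜 := ℝ) Γ π

theorem pd_comp_inclΓ (Γ : ℝ) (f : (Fin 4 → ℝ) → ℝ) (hf : Differentiable ℝ f)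
    (π : Fin 3 → ℝ) (i : Fin 3) :
    pd i (f ∘ inclΓ Γ) π = pd4 i.castSucc f (inclΓ Γ π) := by
  unfold pd pd4
  rw [((hf (inclΓ Γ π)).hasFDerivAt.comp π (inclΓ_hasFDerivAt Γ π)).fderiv]
  rw [ContinuousLinearMap.comp_apply]
  congr 1
  ext j
  fin_cases i <;> fin_cases j <;> simp [Pi.single_apply]

/-- `ι_Γ` is a Poisson map from the magnetic bracket on ℝ³ to the oscillator bracket
on ℝ⁴: the hyperplane `p = Γ` is a Poisson submanifold of `osc*`. -/
theorem inclΓ_poisson_map (Γ : ℝ) (f g : (Fin 4 → ℝ) → ℝ)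
    (hf : Differentiable ℝ f) (hg : Differentiable ℝ g) :
    ∀ π : Fin 3 → ℝ,
      oscPoisson f g (inclΓ Γ π) = magBracket Γ (f ∘ inclΓ Γ) (g ∘ inclΓ Γ) π := by
  intro π
  unfold magBracket oscPoisson
  simp only [pd_comp_inclΓ Γ f hf, pd_comp_inclΓ Γ g hg]
  rfl
end

section
/- Let M be an invertible symmetric 3×3 real matrix and define the Hamiltonian H_osc : ℝ⁴ → ℝ by H_osc(Π, Pₓ, P_y, p) = (1/2)(Π, Pₓ, P_y) · (M⁻¹ (Π, Pₓ, P_y)) + p²/2. Then for every differentiable function F : ℝ⁴ → ℝ and every ν = (Π, Pₓ, P_y, p) ∈ ℝ⁴, {F, H_osc}_osc(ν) = ∇F(ν) · (Pₓ V_y − P_y Vₓ, P_y Ω − p V_y, −Pₓ Ω + p Vₓ, 0), where (Ω, Vₓ, V_y) := M⁻¹ (Π, Pₓ, P_y). In particular, the Hamiltonian flow of H_osc on osc* preserves the coordinate p, and on the invariant hyperplane p = Γ it coincides with the Chaplygin–Lamb equations for the rigid body with circulation Γ. -/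
open Matrix

/-- Projection of `ν = (Π, Pₓ, P_y, p)` onto its first three components. -/
def proj3 (ν : Fin 4 → ℝ) : Fin 3 → ℝ := fun i => ν (Fin.castSucc i)

lemma pd4_kin (A : Matrix (Fin 3) (Fin 3) ℝ) (hA : Aᵀ = A) (ν : Fin 4 → ℝ) (i : Fin 3) :
    pd4 (Fin.castSucc i)
      (fun μ => (1 / 2) * (proj3 μ ⬝ᵥ (A *ᵥ proj3 μ)) + (μ 3) ^ 2 / 2) ν = (A *ᵥ proj3 ν) i := by
  have hd : Differentiable ℝ
      (fun μ : Fin 4 → ℝ => (1 / 2) * (proj3 μ ⬝ᵥ (A *ᵥ proj3 μ)) + (μ 3) ^ 2 / 2) := by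
    simp only [dotProduct, mulVec, proj3]
    fun_prop
  have h1 := (hd ν).hasFDerivAt.hasLineDerivAt (Pi.single (Fin.castSucc i) 1)
  unfold pd4
  refine h1.unique ?_
  unfold HasLineDerivAt
  have e : (fun t : ℝ => (1 / 2) * (proj3 (ν + t • Pi.single (Fin.castSucc i) 1) ⬝ᵥ
        (A *ᵥ proj3 (ν + t • Pi.single (Fin.castSucc i) 1)))
        + ((ν + t • (Pi.single (Fin.castSucc i) 1 : Fin 4 → ℝ)) 3) ^ 2 / 2)
      = fun t : ℝ => ((1 / 2) * (proj3 ν ⬝ᵥ (A *ᵥ proj3 ν)) + (ν 3) ^ 2 / 2)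
        + t * (A *ᵥ proj3 ν) i + t ^ 2 * (A i i / 2) := by
    funext t
    have h01 : A 1 0 = A 0 1 := congrFun (congrFun hA 0) 1
    have h02 : A 2 0 = A 0 2 := congrFun (congrFun hA 0) 2
    have h12 : A 2 1 = A 1 2 := congrFun (congrFun hA 1) 2
    have hp : ∀ j : Fin 3, proj3 (ν + t • Pi.single (Fin.castSucc i) 1) j
        = proj3 ν j + t * (if j = i then 1 else 0) := by
      intro j
      simp [proj3, Pi.single_apply]
    have h3 : (ν + t • (Pi.single (Fin.castSucc i) 1 : Fin 4 → ℝ)) 3 = ν 3 := by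
      have : (3 : Fin 4) ≠ Fin.castSucc i := by
        fin_cases i <;> decide
      simp [this]
    rw [h3]
    simp only [dotProduct, mulVec, Fin.sum_univ_three, hp]
    rw [h01, h02, h12]
    fin_cases i <;> simp [h01, h02, h12] <;> ring
  rw [e]
  have h2 := (((hasDerivAt_id (0:ℝ)).mul_const ((A *ᵥ proj3 ν) i)).const_add
    ((1 / 2) * (proj3 ν ⬝ᵥ (A *ᵥ proj3 ν)) + (ν 3) ^ 2 / 2)).add
    ((hasDerivAt_pow 2 (0:ℝ)).mul_const (A i i / 2))
  refine h2.congr_deriv ?_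
  simp

/-- Hamilton's equations on `osc*` for the Hamiltonian
`H_osc(Π, Pₓ, P_y, p) = (1/2)(Π,Pₓ,P_y)·(M⁻¹(Π,Pₓ,P_y)) + p²/2` preserve `p`, and on
`p = Γ` coincide with the Chaplygin–Lamb equations. -/
theorem oscPoisson_kinetic_hamiltonian
    (M : Matrix (Fin 3) (Fin 3) ℝ) (hM : IsUnit M.det) (hMsymm : Mᵀ = M)
    (F : (Fin 4 → ℝ) → ℝ) (hF : Differentiable ℝ F) :
    ∀ ν : Fin 4 → ℝ,
      oscPoisson F
        (fun μ => (1 / 2) * (proj3 μ ⬝ᵥ (M⁻¹ *ᵥ proj3 μ)) + (μ 3) ^ 2 / 2) ν =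
      pd4 0 F ν * ((ν 1) * (M⁻¹ *ᵥ proj3 ν) 2 - (ν 2) * (M⁻¹ *ᵥ proj3 ν) 1)
        + pd4 1 F ν * ((ν 2) * (M⁻¹ *ᵥ proj3 ν) 0 - (ν 3) * (M⁻¹ *ᵥ proj3 ν) 2)
        + pd4 2 F ν * (-(ν 1) * (M⁻¹ *ᵥ proj3 ν) 0 + (ν 3) * (M⁻¹ *ᵥ proj3 ν) 1)
        + pd4 3 F ν * 0 := by
  intro ν
  have hA : (M⁻¹)ᵀ = M⁻¹ := by rw [Matrix.transpose_nonsing_inv, hMsymm]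
  have h0 := pd4_kin M⁻¹ hA ν 0
  have h1 := pd4_kin M⁻¹ hA ν 1
  have h2 := pd4_kin M⁻¹ hA ν 2
  rw [show Fin.castSucc (0 : Fin 3) = (0 : Fin 4) from rfl] at h0
  rw [show Fin.castSucc (1 : Fin 3) = (1 : Fin 4) from rfl] at h1
  rw [show Fin.castSucc (2 : Fin 3) = (2 : Fin 4) from rfl] at h2
  unfold oscPoisson
  rw [h0, h1, h2]
  ring
end
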